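/- arXiv:1904.01678 — 2 statements merged into one kernel-verified Lean document; each statement's English description precedes it below -/
import Mathlib

section
/- Let v be a weight on ℝⁿ and Y : 𝒬 → (0,∞) a functional on cubes, and suppose X := sup_{b : ‖b‖_{BMO} = 1} ‖b‖_{BMO_{v,Y}} < ∞. Then there exist constants α_n, γ_n ≥ 1 depending only on the dimension n such that for every cube Q with v_Q > 0, (1/|Q|) ∫_Q log⁺( v(x) / (α_n² v_Q) ) v(x) dx ≤ γ_n X Y(Q)/|Q|, where log⁺ t = max{log t, 0} and v_Q = (1/|Q|)∫_Q v. -/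
open MeasureTheory ENNReal Set

noncomputable section

/-- The axis-parallel cube in `ℝⁿ` with lower corner `a` and side length `h`. -/
def Cube {n : ℕ} (a : Fin n → ℝ) (h : ℝ) : Set (Fin n → ℝ) :=
  Set.univ.pi fun i => Set.Icc (a i) (a i + h)

/-- The concentric double `2Q` of the cube with lower corner `a` and side length `h`. -/
def Cube2 {n : ℕ} (a : Fin n → ℝ) (h : ℝ) : Set (Fin n → ℝ) :=
  Cube (fun i => a i - h / 2) (2 * h)

/-- The average `f_Q` of `f` over the cube with lower corner `a` and side length `h`. -/
def cubeAvg {n : ℕ} (a : Fin n → ℝ) (h : ℝ) (f : (Fin n → ℝ) → ℝ) : ℝ :=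
  ⨍ x in Cube a h, f x

/-- The (uncentered) Hardy–Littlewood maximal function over axis-parallel cubes. -/
def maxFn {n : ℕ} (f : (Fin n → ℝ) → ℝ) (x : Fin n → ℝ) : ℝ≥0∞ :=
  ⨆ (a : Fin n → ℝ) (h : ℝ) (_ : 0 < h) (_ : x ∈ Cube a h),
    (∫⁻ y in Cube a h, ENNReal.ofReal |f y|) / volume (Cube a h)

/-- The BMO seminorm `sup_Q (1/|Q|) ∫_Q |f - f_Q|`, valued in `ℝ≥0∞`. -/
def bmoNorm {n : ℕ} (f : (Fin n → ℝ) → ℝ) : ℝ≥0∞ :=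
  ⨆ (a : Fin n → ℝ) (h : ℝ) (_ : 0 < h),
    (∫⁻ x in Cube a h, ENNReal.ofReal |f x - cubeAvg a h f|) / volume (Cube a h)

/-- The generalized weighted BMO norm `‖f‖_{BMO_{v,Y}} = sup_Q (1/Y(Q)) ∫_Q |f - f_Q| v`. -/
def bmoVY {n : ℕ} (v : (Fin n → ℝ) → ℝ) (Y : (Fin n → ℝ) → ℝ → ℝ≥0∞)
    (f : (Fin n → ℝ) → ℝ) : ℝ≥0∞ :=
  ⨆ (a : Fin n → ℝ) (h : ℝ) (_ : 0 < h),
    (∫⁻ x in Cube a h, ENNReal.ofReal (|f x - cubeAvg a h f| * v x)) / Y a h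

/-- `w(Q) = ∫_Q w` for a cube `Q`. -/
def wInt {n : ℕ} (w : (Fin n → ℝ) → ℝ) (a : Fin n → ℝ) (h : ℝ) : ℝ≥0∞ :=
  ∫⁻ x in Cube a h, ENNReal.ofReal (w x)

/-- `w(2Q) = ∫_{2Q} w` for a cube `Q`. -/
def wInt2 {n : ℕ} (w : (Fin n → ℝ) → ℝ) (a : Fin n → ℝ) (h : ℝ) : ℝ≥0∞ :=
  ∫⁻ x in Cube2 a h, ENNReal.ofReal (w x)

/-- The generalized Fujii–Wilson constant `[v]_{A_{∞,Y}} = sup_Q (1/Y(Q)) ∫_Q M(v χ_Q)`. -/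
def fwY {n : ℕ} (v : (Fin n → ℝ) → ℝ) (Y : (Fin n → ℝ) → ℝ → ℝ≥0∞) : ℝ≥0∞ :=
  ⨆ (a : Fin n → ℝ) (h : ℝ) (_ : 0 < h),
    (∫⁻ x in Cube a h, maxFn ((Cube a h).indicator v) x) / Y a h

/-- The Fujii–Wilson `A∞` constant `[w]_{A∞} = sup_Q (1/w(Q)) ∫_Q M(w χ_Q)`. -/
def fwConst {n : ℕ} (w : (Fin n → ℝ) → ℝ) : ℝ≥0∞ :=
  ⨆ (a : Fin n → ℝ) (h : ℝ) (_ : 0 < h),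
    (∫⁻ x in Cube a h, maxFn ((Cube a h).indicator w) x) / wInt w a h

/-- The weak Fujii–Wilson constant `[w]^{weak}_{A∞} = sup_Q (1/w(2Q)) ∫_Q M(w χ_Q)`. -/
def fwWeak {n : ℕ} (w : (Fin n → ℝ) → ℝ) : ℝ≥0∞ :=
  ⨆ (a : Fin n → ℝ) (h : ℝ) (_ : 0 < h),
    (∫⁻ x in Cube a h, maxFn ((Cube a h).indicator w) x) / wInt2 w a h

/-- The `C_p` normalizing functional `Y(Q) = ∫_{ℝⁿ} M(χ_Q)^p w`. -/
def cpY {n : ℕ} (p : ℝ) (w : (Fin n → ℝ) → ℝ) (a : Fin n → ℝ) (h : ℝ) : ℝ≥0∞ :=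
  ∫⁻ x, (maxFn ((Cube a h).indicator fun _ => (1 : ℝ)) x) ^ p * ENNReal.ofReal (w x)

/-- The `C_p` Fujii–Wilson-type constant `[w]_{C_p}`. -/
def cpConst {n : ℕ} (p : ℝ) (w : (Fin n → ℝ) → ℝ) : ℝ≥0∞ :=
  ⨆ (a : Fin n → ℝ) (h : ℝ) (_ : 0 < h),
    (∫⁻ x in Cube a h, maxFn ((Cube a h).indicator w) x) / cpY p w a h

/-- The `A_p` constant `[w]_{A_p}` for `1 < p < ∞`. -/
def apConst {n : ℕ} (p : ℝ) (w : (Fin n → ℝ) → ℝ) : ℝ≥0∞ :=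
  ⨆ (a : Fin n → ℝ) (h : ℝ) (_ : 0 < h),
    (wInt w a h / volume (Cube a h)) *
      ((∫⁻ x in Cube a h, ENNReal.ofReal (w x) ^ (1 - p / (p - 1))) / volume (Cube a h)) ^ (p - 1)

/-- A weight: a nonnegative locally integrable function on `ℝⁿ`. -/
def IsWeight {n : ℕ} (v : (Fin n → ℝ) → ℝ) : Prop :=
  (∀ x, 0 ≤ v x) ∧ LocallyIntegrable v volume

/-- A cube functional `Y : 𝒬 → (0,∞)`: positive finite values on cubes. -/
def IsCubeFunctional {n : ℕ} (Y : (Fin n → ℝ) → ℝ → ℝ≥0∞) : Prop :=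
  ∀ (a : Fin n → ℝ) (h : ℝ), 0 < h → 0 < Y a h ∧ Y a h < ⊤

/-- Membership in the class `𝒴_q` with constant `β`: for every cube `Q`, every `L ≥ 1`
and every `L`-small family of pairwise non-overlapping subcubes of `Q`,
`∑_{P ∈ Λ} Y(P) ≤ β Y(Q) L^{-1/q}`. -/
def MemY {n : ℕ} (q β : ℝ) (Y : (Fin n → ℝ) → ℝ → ℝ≥0∞) : Prop :=
  ∀ (a : Fin n → ℝ) (h : ℝ), 0 < h → ∀ L : ℝ, 1 ≤ L →
    ∀ Λ : Set ((Fin n → ℝ) × ℝ),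
      (∀ p ∈ Λ, 0 < p.2 ∧ Cube p.1 p.2 ⊆ Cube a h) →
      (Λ.Pairwise fun p r => Disjoint (interior (Cube p.1 p.2)) (interior (Cube r.1 r.2))) →
      (∑' p : Λ, volume (Cube p.1.1 p.1.2)) ≤ volume (Cube a h) / ENNReal.ofReal L →
      (∑' p : Λ, Y p.1.1 p.1.2) ≤ ENNReal.ofReal β * Y a h * ENNReal.ofReal (L ^ (-1 / q))

/-- The Luxemburg norm in the Orlicz space `exp L^β` with respect to the measure `μ`. -/
def expLuxNorm {X : Type*} [MeasurableSpace X] (μ : Measure X) (β : ℝ) (g : X → ℝ) : ℝ≥0∞ :=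
  ⨅ (lam : ℝ) (_ : 0 < lam)
    (_ : ∫⁻ x, ENNReal.ofReal (Real.exp ((|g x| / lam) ^ β) - 1) ∂μ ≤ 1), ENNReal.ofReal lam

/-- The weighted measure `w dx` restricted to a set `Q`. -/
def wMeasureOn {n : ℕ} (w : (Fin n → ℝ) → ℝ) (Q : Set (Fin n → ℝ)) : Measure (Fin n → ℝ) :=
  (volume.restrict Q).withDensity fun x => ENNReal.ofReal (w x)

/-- The dyadic grid `𝒟(Q)` relative to the cube with lower corner `a₀` and side `h₀`:
parameters of all dyadic subcubes of `Q`. -/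
def dyadicOf {n : ℕ} (a₀ : Fin n → ℝ) (h₀ : ℝ) : Set ((Fin n → ℝ) × ℝ) :=
  {p | ∃ (k : ℕ) (m : Fin n → ℕ), (∀ i, m i < 2 ^ k) ∧
    p.2 = h₀ / 2 ^ k ∧ p.1 = fun i => a₀ i + (m i : ℝ) * (h₀ / 2 ^ k)}

/-- The functional `w_r(Q) = |Q| ((1/|Q|) ∫_Q w^r)^{1/r}`. -/
def wrY {n : ℕ} (w : (Fin n → ℝ) → ℝ) (r : ℝ) (a : Fin n → ℝ) (h : ℝ) : ℝ≥0∞ :=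
  volume (Cube a h) *
    ((∫⁻ x in Cube a h, ENNReal.ofReal (w x) ^ r) / volume (Cube a h)) ^ (1 / r)

/-- The uncentered Hardy–Littlewood maximal function of a measure, over sup-norm balls. -/
def hlMax {n : ℕ} (μ : Measure (Fin n → ℝ)) (x : Fin n → ℝ) : ℝ≥0∞ :=
  ⨆ (z : Fin n → ℝ) (r : ℝ) (_ : x ∈ Metric.ball z r),
    μ (Metric.closedBall z r) / volume (Metric.closedBall z r)

lemma volume_closedBall_mul {n : ℕ} (z z' : Fin n → ℝ) {k r : ℝ} (hk : 0 ≤ k) (hr : 0 ≤ r) :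
    volume (Metric.closedBall z (k * r)) =
      ENNReal.ofReal k ^ n * volume (Metric.closedBall z' r) := by
  rw [Real.volume_pi_closedBall z (mul_nonneg hk hr), Real.volume_pi_closedBall z' hr,
    Fintype.card_fin, ← ENNReal.ofReal_pow hk, ← ENNReal.ofReal_mul (by positivity), ← mul_pow]
  ring_nf

lemma volume_closedBall_ne_zero {n : ℕ} (z : Fin n → ℝ) {r : ℝ} (hr : 0 < r) :
    volume (Metric.closedBall z r) ≠ 0 :=
  (Metric.measure_closedBall_pos volume z hr).ne'

lemma volume_closedBall_ne_top {n : ℕ} (z : Fin n → ℝ) (r : ℝ) :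
    volume (Metric.closedBall z r) ≠ ⊤ :=
  measure_closedBall_lt_top.ne

lemma measure_closedBall_le_hlMax {n : ℕ} (μ : Measure (Fin n → ℝ)) {x z : Fin n → ℝ} {r : ℝ}
    (hx : x ∈ Metric.ball z r) :
    μ (Metric.closedBall z r) ≤ hlMax μ x * volume (Metric.closedBall z r) := by
  have hr : 0 < r := Metric.pos_of_mem_ball hx
  rw [← ENNReal.div_le_iff (volume_closedBall_ne_zero z hr) (volume_closedBall_ne_top z r)]
  exact le_iSup_of_le z (le_iSup_of_le r (le_iSup_of_le hx le_rfl))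

lemma exists_ball_of_lt_hlMax {n : ℕ} {μ : Measure (Fin n → ℝ)} {x : Fin n → ℝ} {s : ℝ≥0∞}
    (h : s < hlMax μ x) : ∃ (z : Fin n → ℝ) (r : ℝ), x ∈ Metric.ball z r ∧
      s < μ (Metric.closedBall z r) / volume (Metric.closedBall z r) := by
  simpa only [hlMax, lt_iSup_iff, exists_prop] using h

lemma measurable_hlMax {n : ℕ} (μ : Measure (Fin n → ℝ)) : Measurable (hlMax μ) := by
  refine measurable_of_Ioi fun s => (IsOpen.measurableSet ?_)
  rw [Metric.isOpen_iff]
  intro x hx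
  obtain ⟨z, r, hxz, hs⟩ := exists_ball_of_lt_hlMax hx
  obtain ⟨ε, hε, hsub⟩ := Metric.isOpen_iff.1 Metric.isOpen_ball x hxz
  exact ⟨ε, hε, fun y hy =>
    hs.trans_le (le_iSup_of_le z (le_iSup_of_le r (le_iSup_of_le (hsub hy) le_rfl)))⟩

lemma mul_volume_le_of_closedBall_cover {n : ℕ} (μ : Measure (Fin n → ℝ)) (E U : Set (Fin n → ℝ))
    (R : ℝ) (s : ℝ≥0∞)
    (h : ∀ x ∈ E, ∃ (z : Fin n → ℝ) (ρ : ℝ), 0 < ρ ∧ ρ ≤ R ∧ x ∈ Metric.closedBall z ρ ∧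
      Metric.closedBall z ρ ⊆ U ∧
      s * volume (Metric.closedBall z ρ) ≤ μ (Metric.closedBall z ρ)) :
    s * volume E ≤ 5 ^ n * μ U := by
  choose! z ρ hρ hR hx hU hs using h
  obtain ⟨u, huE, hdisj, hcov⟩ :=
    Vitali.exists_disjoint_subfamily_covering_enlargement_closedBall E z ρ R hR 5 (by norm_num)
  have hcount : u.Countable := hdisj.countable_of_nonempty_interior fun a ha =>
    ⟨z a, Metric.ball_subset_interior_closedBall (Metric.mem_ball_self (hρ a (huE ha)))⟩
  have hE : E ⊆ ⋃ b ∈ u, Metric.closedBall (z b) (5 * ρ b) := fun x hxE => by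
    obtain ⟨b, hb, hsub⟩ := hcov x hxE
    exact mem_biUnion hb (hsub (hx x hxE))
  have : Countable u := hcount
  calc s * volume E ≤ s * ∑' b : u, volume (Metric.closedBall (z b) (5 * ρ b)) := by
        gcongr
        exact (measure_mono hE).trans (measure_biUnion_le _ hcount _)
    _ = ∑' b : u, 5 ^ n * (s * volume (Metric.closedBall (z b) (ρ b))) := by
        rw [← ENNReal.tsum_mul_left]
        refine tsum_congr fun b => ?_
        rw [volume_closedBall_mul (z b) (z b) (by norm_num) (hρ b (huE b.2)).le]
        rw [ENNReal.ofReal_ofNat]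
        ring
    _ ≤ ∑' b : u, 5 ^ n * μ (Metric.closedBall (z b) (ρ b)) :=
        ENNReal.tsum_le_tsum fun b => by gcongr; exact hs b (huE b.2)
    _ = 5 ^ n * μ (⋃ b ∈ u, Metric.closedBall (z b) (ρ b)) := by
        rw [ENNReal.tsum_mul_left,
          measure_biUnion hcount hdisj fun _ _ => Metric.isClosed_closedBall.measurableSet]
    _ ≤ 5 ^ n * μ U := by
        gcongr
        exact iUnion₂_subset fun b hb => hU b (huE hb)

lemma mul_volume_hlMax_level_le {n : ℕ} (μ : Measure (Fin n → ℝ)) (p : Fin n → ℝ) {r : ℝ}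
    (K : ℝ≥0∞)
    (hbig : ∀ (z : Fin n → ℝ) (ρ : ℝ), r < ρ →
      (Metric.closedBall p r ∩ Metric.ball z ρ).Nonempty →
      μ (Metric.closedBall z ρ) ≤ K * volume (Metric.closedBall z ρ))
    (hsmall : μ (Metric.closedBall p (3 * r)) ≤ K * volume (Metric.closedBall p r))
    {s : ℝ≥0∞} (hs : K ≤ s) :
    s * volume (Metric.closedBall p r ∩ {x | s < hlMax μ x}) ≤
      5 ^ n * (K * volume (Metric.closedBall p r)) := by
  refine (mul_volume_le_of_closedBall_cover μ _ (Metric.closedBall p (3 * r)) r s ?_).trans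
    (by gcongr)
  rintro x ⟨hxp, hx⟩
  obtain ⟨z, ρ, hxz, hlt⟩ := exists_ball_of_lt_hlMax hx
  have hρ : 0 < ρ := Metric.pos_of_mem_ball hxz
  have hlt' : s * volume (Metric.closedBall z ρ) < μ (Metric.closedBall z ρ) :=
    (ENNReal.lt_div_iff_mul_lt (Or.inl (volume_closedBall_ne_zero z hρ))
      (Or.inl (volume_closedBall_ne_top z ρ))).1 hlt
  have hρr : ρ ≤ r := by
    by_contra! hc
    exact absurd ((hbig z ρ hc ⟨x, hxp, hxz⟩).trans (by gcongr)) hlt'.not_ge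
  refine ⟨z, ρ, hρ, hρr, Metric.ball_subset_closedBall hxz, ?_, hlt'.le⟩
  refine Metric.closedBall_subset_closedBall' ?_
  have h1 := Metric.mem_closedBall.1 hxp
  have h2 := Metric.mem_ball'.1 hxz
  linarith [dist_triangle z x p]

lemma lintegral_posLog_le {X : Type*} [MeasurableSpace X] (ν : Measure X) (m : X → ℝ)
    (hm : Measurable m) (hm0 : ∀ x, 0 ≤ m x) {K : ℝ} (hK : 0 < K) {D : ℝ≥0∞}
    (h : ∀ s : ℝ, K ≤ s → ENNReal.ofReal s * ν {x | s < m x} ≤ ENNReal.ofReal K * D) :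
    ∫⁻ x, ENNReal.ofReal (Real.posLog (m x / K)) ∂ν ≤ D := by
  have hmeas : Measurable fun x => Real.posLog (m x / K) :=
    Real.continuous_posLog.measurable.comp (hm.div_const K)
  rw [lintegral_eq_lintegral_meas_lt ν (ae_of_all _ fun x => Real.posLog_nonneg)
    hmeas.aemeasurable]
  calc ∫⁻ t in Ioi (0 : ℝ), ν {x | t < Real.posLog (m x / K)}
      ≤ ∫⁻ t in Ioi (0 : ℝ), ENNReal.ofReal (Real.exp (-t)) * D := by
        refine setLIntegral_mono' measurableSet_Ioi fun t ht => ?_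
        have hsub : {x | t < Real.posLog (m x / K)} ⊆ {x | K * Real.exp t < m x} := by
          intro x hx
          have ht' : (0 : ℝ) < t := ht
          have hx1 : t < Real.log (m x / K) := by
            rcases lt_max_iff.1 (show t < max 0 (Real.log (m x / K)) from hx) with h0 | h0
            · linarith
            · exact h0
          have hpos : 0 < m x / K := by
            rcases (div_nonneg (hm0 x) hK.le).eq_or_lt with h0 | h0
            · rw [← h0, Real.log_zero] at hx1; linarith
            · exact h0
          have := (Real.lt_log_iff_exp_lt hpos).1 hx1
          rw [lt_div_iff₀ hK] at this
          simpa [mul_comm] using this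
        have h1 := h (K * Real.exp t) (le_mul_of_one_le_right hK.le (Real.one_le_exp (le_of_lt ht)))
        rw [ENNReal.ofReal_mul hK.le, mul_assoc,
          ENNReal.mul_le_mul_iff_right (by simpa using hK) ENNReal.ofReal_ne_top] at h1
        refine (measure_mono hsub).trans ?_
        rw [Real.exp_neg, ENNReal.ofReal_inv_of_pos (Real.exp_pos t)]
        rwa [← ENNReal.div_eq_inv_mul, ENNReal.le_div_iff_mul_le (by simp [Real.exp_pos])
          (by simp), mul_comm]
    _ = D := by
        rw [lintegral_mul_const _ (by fun_prop)]
        rw [← ofReal_integral_eq_lintegral_ofReal (integrableOn_exp_neg_Ioi 0)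
          (ae_of_all _ fun t => (Real.exp_pos _).le), integral_exp_neg_Ioi_zero]
        simp

lemma volume_closedBall_mono {n : ℕ} (z z' : Fin n → ℝ) {r ρ : ℝ} (hr : 0 ≤ r) (h : r ≤ ρ) :
    volume (Metric.closedBall z r) ≤ volume (Metric.closedBall z' ρ) := by
  rw [Real.volume_pi_closedBall z hr, Real.volume_pi_closedBall z' (hr.trans h)]
  gcongr

lemma ofReal_lt_of_lt_toReal {s : ℝ} {t : ℝ≥0∞} (hs : 0 ≤ s) (h : s < t.toReal) :
    ENNReal.ofReal s < t :=
  ((ENNReal.ofReal_lt_ofReal_iff (hs.trans_lt h)).2 h).trans_le ENNReal.ofReal_toReal_le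

lemma lintegral_posLog_hlMax_le {n : ℕ} (μ : Measure (Fin n → ℝ)) (p : Fin n → ℝ) {r K : ℝ}
    (hK : 0 < K)
    (hbig : ∀ (z : Fin n → ℝ) (ρ : ℝ), r < ρ →
      (Metric.closedBall p r ∩ Metric.ball z ρ).Nonempty →
      μ (Metric.closedBall z ρ) ≤ ENNReal.ofReal K * volume (Metric.closedBall z ρ))
    (hsmall : μ (Metric.closedBall p (3 * r)) ≤
      ENNReal.ofReal K * volume (Metric.closedBall p r)) :
    ∫⁻ x in Metric.closedBall p r, ENNReal.ofReal (Real.posLog ((hlMax μ x).toReal / K)) ≤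
      5 ^ n * volume (Metric.closedBall p r) := by
  refine lintegral_posLog_le _ _ (measurable_hlMax μ).ennreal_toReal
    (fun x => ENNReal.toReal_nonneg) hK fun s hs => ?_
  have h := mul_volume_hlMax_level_le μ p _ hbig hsmall (ENNReal.ofReal_le_ofReal hs)
  rw [mul_left_comm] at h
  refine le_trans ?_ h
  rw [Measure.restrict_apply
    (measurableSet_lt measurable_const (measurable_hlMax μ).ennreal_toReal), inter_comm]
  gcongr
  exact fun hx => ofReal_lt_of_lt_toReal (hK.le.trans hs) hx

lemma ae_hlMax_lt_top {n : ℕ} (μ : Measure (Fin n → ℝ)) [IsFiniteMeasure μ] :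
    ∀ᵐ x, hlMax μ x < ⊤ := by
  have key : ∀ k : ℕ,
      volume (Metric.closedBall (0 : Fin n → ℝ) (k + 1) ∩ {x | hlMax μ x = ⊤}) = 0 := by
    intro k
    set P := Metric.closedBall (0 : Fin n → ℝ) (k + 1) with hP
    have hr : (0 : ℝ) < k + 1 := by positivity
    have hP0 : volume P ≠ 0 := volume_closedBall_ne_zero _ hr
    have hPt : volume P ≠ ⊤ := volume_closedBall_ne_top _ _
    have hKP : μ univ / volume P * volume P = μ univ := ENNReal.div_mul_cancel hP0 hPt
    have hlev : ∀ s : ℝ≥0∞, μ univ / volume P ≤ s →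
        s * volume (P ∩ {x | s < hlMax μ x}) ≤ 5 ^ n * μ univ := by
      intro s hs
      rw [← hKP]
      refine mul_volume_hlMax_level_le μ 0 (μ univ / volume P) ?_ ?_ hs
      · intro z ρ hρ _
        calc μ (Metric.closedBall z ρ) ≤ μ univ / volume P * volume P := by
              rw [hKP]; exact measure_mono (subset_univ _)
          _ ≤ _ := mul_le_mul_right (volume_closedBall_mono _ _ hr.le hρ.le) _
      · rw [← hP, hKP]; exact measure_mono (subset_univ _)
    by_contra hne
    set V := volume (P ∩ {x | hlMax μ x = ⊤})
    have hVt : V ≠ ⊤ := ne_top_of_le_ne_top hPt (measure_mono inter_subset_left)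
    have hC : 5 ^ n * μ univ ≠ ⊤ := ENNReal.mul_ne_top (by simp) (measure_ne_top _ _)
    have hs0 : (5 ^ n * μ univ + 1) / V ≠ ⊤ := ENNReal.div_ne_top (by simpa using hC) hne
    have hs1 : μ univ / volume P ≠ ⊤ := ENNReal.div_ne_top (measure_ne_top _ _) hP0
    have h1 := hlev (μ univ / volume P + (5 ^ n * μ univ + 1) / V) le_self_add
    have h2 : (5 ^ n * μ univ + 1) / V * V ≤ 5 ^ n * μ univ := by
      refine le_trans ?_ h1
      gcongr
      · exact le_add_self
      · refine measure_mono (inter_subset_inter_right _ fun x hx => ?_)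
        simp only [mem_ofPred_eq] at hx ⊢
        rw [hx]
        exact ENNReal.add_lt_top.2 ⟨hs1.lt_top, hs0.lt_top⟩
    rw [ENNReal.div_mul_cancel hne hVt] at h2
    exact absurd h2 (ENNReal.lt_add_right hC one_ne_zero).not_ge
  rw [ae_iff]
  refine measure_mono_null ?_ (measure_iUnion_null key)
  intro x hx
  obtain ⟨k, hk⟩ := exists_nat_ge (dist x 0)
  exact mem_iUnion.2 ⟨k, Metric.mem_closedBall.2 (by linarith), by simpa using hx⟩

lemma posLog_div_le {m c K : ℝ} (hm : 0 ≤ m) (hc : 0 < c) (hcK : c ≤ K) :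
    Real.posLog (m / c) ≤ Real.posLog (m / K) + Real.log (K / c) := by
  have hK : 0 < K := hc.trans_le hcK
  have hl : 0 ≤ Real.log (K / c) := Real.log_nonneg ((one_le_div hc).2 hcK)
  rw [Real.posLog_apply (x := m / c)]
  refine max_le (add_nonneg Real.posLog_nonneg hl) ?_
  rcases hm.eq_or_lt with rfl | hm
  · simpa using hl
  have : Real.log (m / c) = Real.log (m / K) + Real.log (K / c) := by
    rw [← Real.log_mul (by positivity) (by positivity)]
    congr 1
    field_simp
  rw [this]
  gcongr
  exact le_max_right _ _

lemma log_div_le_posLog {m c A : ℝ} (hm : 0 ≤ m) (hc : 0 < c) (hA : 0 < A) (h : A ≤ max c m) :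
    Real.log (A / c) ≤ Real.posLog (m / c) := by
  rw [Real.posLog_eq_log_max_one (by positivity)]
  refine Real.log_le_log (by positivity) ?_
  rw [div_le_iff₀ hc, max_mul_of_nonneg _ _ hc.le, div_mul_cancel₀ _ hc.ne', one_mul]
  exact h

lemma exists_lintegral_abs_posLog_hlMax_sub_le {n : ℕ} (μ : Measure (Fin n → ℝ))
    [IsFiniteMeasure μ] {c : ℝ} (hc : 0 < c) (p : Fin n → ℝ) {r : ℝ} (hr : 0 < r) :
    ∃ k : ℝ, ∫⁻ x in Metric.closedBall p r,
        ENNReal.ofReal |Real.posLog ((hlMax μ x).toReal / c) - k| ≤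
      ENNReal.ofReal (5 ^ n + n * Real.log 3) * volume (Metric.closedBall p r) := by
  set P := Metric.closedBall p r with hP
  have hP0 : volume P ≠ 0 := volume_closedBall_ne_zero _ hr
  set A : ℝ≥0∞ := ⨅ y ∈ P, max (ENNReal.ofReal c) (hlMax μ y) with hA
  have hAle : ∀ y ∈ P, A ≤ max (ENNReal.ofReal c) (hlMax μ y) := fun y hy => iInf₂_le y hy
  have hcA : ENNReal.ofReal c ≤ A := le_iInf₂ fun y _ => le_max_left _ _
  have hfin := ae_hlMax_lt_top μ
  have hAt : A ≠ ⊤ := by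
    have : ∃ y ∈ P, hlMax μ y < ⊤ := by
      by_contra! hcon
      refine hP0 (measure_mono_null (fun y hy => ?_) (ae_iff.1 hfin))
      exact (hcon y hy).not_gt
    obtain ⟨y, hy, hyt⟩ := this
    exact ((hAle y hy).trans_lt (max_lt ENNReal.ofReal_lt_top hyt)).ne
  have hcA' : c ≤ A.toReal := (ENNReal.ofReal_le_iff_le_toReal hAt).1 hcA
  have hA0 : 0 < A.toReal := hc.trans_le hcA'
  set K : ℝ := 3 ^ n * A.toReal with hKdef
  have h3 : (1 : ℝ) ≤ 3 ^ n := one_le_pow₀ (by norm_num)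
  have hK0 : 0 < K := by positivity
  have hAK : A.toReal ≤ K := le_mul_of_one_le_left hA0.le h3
  have hKof : ENNReal.ofReal K = 3 ^ n * A := by
    rw [hKdef, ENNReal.ofReal_mul (by positivity), ENNReal.ofReal_toReal hAt,
      ENNReal.ofReal_pow (by norm_num), ENNReal.ofReal_ofNat]
  have hμ : ∀ (z : Fin n → ℝ) (ρ : ℝ), 0 < ρ → P ⊆ Metric.ball z (3 * ρ) →
      μ (Metric.closedBall z (3 * ρ)) ≤ ENNReal.ofReal K * volume (Metric.closedBall z ρ) := by
    intro z ρ hρ hsub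
    have hρ3 : 0 < 3 * ρ := by positivity
    have h0 := volume_closedBall_ne_zero z hρ3
    have ht := volume_closedBall_ne_top z (3 * ρ)
    have hle : μ (Metric.closedBall z (3 * ρ)) / volume (Metric.closedBall z (3 * ρ)) ≤ A :=
      le_iInf₂ fun y hy => le_max_of_le_right
        ((ENNReal.div_le_iff h0 ht).2 (measure_closedBall_le_hlMax μ (hsub hy)))
    rw [ENNReal.div_le_iff h0 ht] at hle
    refine hle.trans_eq ?_
    rw [hKof, volume_closedBall_mul z z (by norm_num) hρ.le, ENNReal.ofReal_ofNat]
    ring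
  have hlog := lintegral_posLog_hlMax_le μ p hK0
    (fun z ρ hρ hne => by
      have hρ0 : 0 < ρ := hr.trans hρ
      refine (measure_mono (Metric.closedBall_subset_closedBall (by linarith))).trans
        (hμ z ρ hρ0 fun y hy => ?_)
      obtain ⟨x, hxP, hxz⟩ := hne
      have h1 := Metric.mem_closedBall.1 hy
      have h2 := Metric.mem_closedBall'.1 hxP
      have h3 := Metric.mem_ball.1 hxz
      rw [Metric.mem_ball]
      linarith [dist_triangle y p z, dist_triangle p x z])
    (hμ p r hr (Metric.closedBall_subset_ball (by linarith)))
  refine ⟨Real.log (K / c), ?_⟩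
  have hlogK : Real.log (K / c) = Real.log (A.toReal / c) + n * Real.log 3 := by
    rw [← Real.log_pow, ← Real.log_mul (by positivity) (by positivity), hKdef]
    congr 1
    ring
  have hn3 : 0 ≤ n * Real.log 3 := mul_nonneg n.cast_nonneg (Real.log_nonneg (by norm_num))
  calc ∫⁻ x in P, ENNReal.ofReal |Real.posLog ((hlMax μ x).toReal / c) - Real.log (K / c)|
      ≤ ∫⁻ x in P, (ENNReal.ofReal (Real.posLog ((hlMax μ x).toReal / K)) +
          ENNReal.ofReal (n * Real.log 3)) := by
        refine setLIntegral_mono_ae' Metric.isClosed_closedBall.measurableSet ?_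
        filter_upwards [hfin] with x hx hxP
        rw [← ENNReal.ofReal_add Real.posLog_nonneg hn3]
        refine ENNReal.ofReal_le_ofReal (abs_le.2 ⟨?_, ?_⟩)
        · have hAm : A.toReal ≤ max c (hlMax μ x).toReal := by
            have := ENNReal.toReal_mono (max_lt ENNReal.ofReal_lt_top hx).ne (hAle x hxP)
            rwa [ENNReal.toReal_max ENNReal.ofReal_ne_top hx.ne,
              ENNReal.toReal_ofReal hc.le] at this
          have h1 := log_div_le_posLog ENNReal.toReal_nonneg hc hA0 hAm
          have h2 : 0 ≤ Real.posLog ((hlMax μ x).toReal / K) := Real.posLog_nonneg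
          linarith
        · have h1 := posLog_div_le (m := (hlMax μ x).toReal) ENNReal.toReal_nonneg hc
            (hcA'.trans hAK)
          linarith
    _ ≤ 5 ^ n * volume P + ENNReal.ofReal (n * Real.log 3) * volume P := by
        rw [lintegral_add_right _ measurable_const, setLIntegral_const]
        gcongr
    _ = ENNReal.ofReal (5 ^ n + n * Real.log 3) * volume P := by
        rw [ENNReal.ofReal_add (by positivity) hn3, ENNReal.ofReal_pow (by norm_num),
          ENNReal.ofReal_ofNat, add_mul]

lemma integrableOn_of_lintegral_abs_sub_ne_top {X : Type*} [MeasurableSpace X] {ν : Measure X}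
    [IsFiniteMeasure ν] {b : X → ℝ} (hb : Measurable b) {k : ℝ}
    (h : ∫⁻ x, ENNReal.ofReal |b x - k| ∂ν ≠ ⊤) : Integrable b ν := by
  have h1 : Integrable (fun x => b x - k) ν := by
    refine ⟨(hb.sub_const k).aestronglyMeasurable, ?_⟩
    simp only [hasFiniteIntegral_iff_norm, Real.norm_eq_abs]
    exact h.lt_top
  exact (h1.add (integrable_const k)).congr (ae_of_all _ fun x => sub_add_cancel _ _)

lemma lintegral_abs_sub_average_le {X : Type*} [MeasurableSpace X] {ν : Measure X}
    [IsFiniteMeasure ν] {b : X → ℝ} (hb : Integrable b ν) (k : ℝ) :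
    ∫⁻ x, ENNReal.ofReal |b x - ⨍ y, b y ∂ν| ∂ν ≤ 2 * ∫⁻ x, ENNReal.ofReal |b x - k| ∂ν := by
  have hmul : (∫⁻ _, ENNReal.ofReal |k - ⨍ y, b y ∂ν| ∂ν) ≤
      ∫⁻ x, ENNReal.ofReal |b x - k| ∂ν := by
    have h1 : ∫ x, (k - ⨍ y, b y ∂ν) ∂ν = -∫ x, (b x - k) ∂ν := by
      rw [integral_sub (integrable_const _) (integrable_const _),
        integral_sub hb (integrable_const _), integral_average]
      ring
    have h2 : ∫⁻ _, ENNReal.ofReal |k - ⨍ y, b y ∂ν| ∂ν = ‖∫ x, (k - ⨍ y, b y ∂ν) ∂ν‖ₑ := by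
      rw [lintegral_const, integral_const, smul_eq_mul, enorm_mul, mul_comm,
        ← Real.enorm_eq_ofReal_abs, Real.enorm_of_nonneg measureReal_nonneg, measureReal_def,
        ENNReal.ofReal_toReal (measure_ne_top _ _)]
    rw [h2, h1, enorm_neg]
    simpa only [Real.enorm_eq_ofReal_abs] using enorm_integral_le_lintegral_enorm fun x => b x - k
  calc ∫⁻ x, ENNReal.ofReal |b x - ⨍ y, b y ∂ν| ∂ν
      ≤ ∫⁻ x, (ENNReal.ofReal |b x - k| + ENNReal.ofReal |k - ⨍ y, b y ∂ν|) ∂ν := by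
        refine lintegral_mono fun x => ?_
        rw [← ENNReal.ofReal_add (abs_nonneg _) (abs_nonneg _)]
        exact ENNReal.ofReal_le_ofReal (abs_sub_le _ _ _)
    _ ≤ _ := by
        rw [lintegral_add_right _ measurable_const, two_mul]
        gcongr

lemma cube_eq_closedBall {n : ℕ} (a : Fin n → ℝ) {h : ℝ} (hh : 0 < h) :
    Cube a h = Metric.closedBall (fun i => a i + h / 2) (h / 2) := by
  rw [closedBall_pi _ (by positivity), Cube]
  congr! 2 with i
  rw [Real.closedBall_eq_Icc]
  congr 1 <;> ring

lemma locallyIntegrable_posLog_hlMax {n : ℕ} (μ : Measure (Fin n → ℝ)) [IsFiniteMeasure μ]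
    {c : ℝ} (hc : 0 < c) :
    LocallyIntegrable (fun x => Real.posLog ((hlMax μ x).toReal / c)) volume := by
  intro x
  refine ⟨_, Metric.closedBall_mem_nhds x one_pos, ?_⟩
  obtain ⟨k, hk⟩ := exists_lintegral_abs_posLog_hlMax_sub_le μ hc x one_pos
  have : IsFiniteMeasure (volume.restrict (Metric.closedBall x 1)) :=
    isFiniteMeasure_restrict.2 (volume_closedBall_ne_top x 1)
  refine integrableOn_of_lintegral_abs_sub_ne_top ?_ (ne_top_of_le_ne_top ?_ hk)
  · exact Real.continuous_posLog.measurable.comp ((measurable_hlMax μ).ennreal_toReal.div_const c)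
  · exact ENNReal.mul_ne_top ENNReal.ofReal_ne_top (volume_closedBall_ne_top x 1)

lemma bmoNorm_posLog_hlMax_le {n : ℕ} (μ : Measure (Fin n → ℝ)) [IsFiniteMeasure μ]
    {c : ℝ} (hc : 0 < c) :
    bmoNorm (fun x => Real.posLog ((hlMax μ x).toReal / c)) ≤
      ENNReal.ofReal (2 * (5 ^ n + n * Real.log 3)) := by
  refine iSup_le fun a => iSup_le fun h => iSup_le fun hh => ?_
  have hh2 : 0 < h / 2 := by positivity
  rw [cubeAvg, cube_eq_closedBall a hh, ENNReal.div_le_iff (volume_closedBall_ne_zero _ hh2)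
    (volume_closedBall_ne_top _ _)]
  obtain ⟨k, hk⟩ := exists_lintegral_abs_posLog_hlMax_sub_le μ hc (fun i => a i + h / 2) hh2
  have : IsFiniteMeasure (volume.restrict (Metric.closedBall (fun i => a i + h / 2) (h / 2))) :=
    isFiniteMeasure_restrict.2 (volume_closedBall_ne_top _ _)
  have hint := (locallyIntegrable_posLog_hlMax μ hc).integrableOn_isCompact
    (isCompact_closedBall (fun i => a i + h / 2) (h / 2))
  refine (lintegral_abs_sub_average_le hint k).trans ?_
  rw [ENNReal.ofReal_mul (by norm_num), ENNReal.ofReal_ofNat, mul_assoc]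
  gcongr

lemma cubeAvg_const_mul {n : ℕ} (a : Fin n → ℝ) (h t : ℝ) (f : (Fin n → ℝ) → ℝ) :
    cubeAvg a h (fun x => t * f x) = t * cubeAvg a h f := by
  simp only [cubeAvg, average_eq, integral_const_mul, smul_eq_mul]
  ring

lemma bmoNorm_const_mul {n : ℕ} (f : (Fin n → ℝ) → ℝ) {t : ℝ} (ht : 0 ≤ t) :
    bmoNorm (fun x => t * f x) = ENNReal.ofReal t * bmoNorm f := by
  simp only [bmoNorm, ENNReal.mul_iSup]
  refine iSup_congr fun a => iSup_congr fun h => iSup_congr fun _ => ?_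
  rw [← mul_div_assoc, ← lintegral_const_mul' _ _ ENNReal.ofReal_ne_top]
  simp only [cubeAvg_const_mul, ← mul_sub, abs_mul, abs_of_nonneg ht,
    ENNReal.ofReal_mul ht]

/-- The oscillation of a BMO function against `v` is controlled by the supremum of
`bmoVY v Y` over the unit sphere of BMO. -/
lemma lintegral_abs_sub_cubeAvg_mul_le {n : ℕ} {v b : (Fin n → ℝ) → ℝ}
    {Y : (Fin n → ℝ) → ℝ → ℝ≥0∞} (hY : IsCubeFunctional Y) (hb : LocallyIntegrable b volume)
    (hbmo : bmoNorm b ≠ ⊤) (a : Fin n → ℝ) {h : ℝ} (hh : 0 < h) :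
    ∫⁻ x in Cube a h, ENNReal.ofReal (|b x - cubeAvg a h b| * v x) ≤
      bmoNorm b * (⨆ (b : (Fin n → ℝ) → ℝ) (_ : LocallyIntegrable b volume ∧ bmoNorm b = 1),
        bmoVY v Y b) * Y a h := by
  have hh2 : 0 < h / 2 := by positivity
  have hQ0 : volume (Cube a h) ≠ 0 := by
    rw [cube_eq_closedBall a hh]; exact volume_closedBall_ne_zero _ hh2
  have hQt : volume (Cube a h) ≠ ⊤ := by
    rw [cube_eq_closedBall a hh]; exact volume_closedBall_ne_top _ _
  by_cases h0 : bmoNorm b = 0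
  · have h1 : (∫⁻ x in Cube a h, ENNReal.ofReal |b x - cubeAvg a h b|) / volume (Cube a h) ≤ 0 := by
      rw [← h0]
      exact le_iSup_of_le a (le_iSup_of_le h (le_iSup_of_le hh le_rfl))
    have hint : IntegrableOn b (Cube a h) := by
      rw [cube_eq_closedBall a hh]
      exact hb.integrableOn_isCompact (isCompact_closedBall _ _)
    rw [ENNReal.div_le_iff hQ0 hQt, zero_mul, nonpos_iff_eq_zero, lintegral_eq_zero_iff'
      (by have := hint.aemeasurable; fun_prop)] at h1
    have h2 : ∫⁻ x in Cube a h, ENNReal.ofReal (|b x - cubeAvg a h b| * v x) = 0 := by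
      rw [← lintegral_zero]
      refine lintegral_congr_ae ?_
      filter_upwards [h1] with x hx
      have : |b x - cubeAvg a h b| = 0 :=
        le_antisymm (ENNReal.ofReal_eq_zero.1 hx) (abs_nonneg _)
      simp [this]
    rw [h2]
    exact zero_le
  · set N := (bmoNorm b).toReal with hN
    have hN0 : 0 < N := ENNReal.toReal_pos h0 hbmo
    have hNof : bmoNorm b = ENNReal.ofReal N := (ENNReal.ofReal_toReal hbmo).symm
    have hone : bmoNorm (fun x => N⁻¹ * b x) = 1 := by
      rw [bmoNorm_const_mul _ (by positivity), hNof, ← ENNReal.ofReal_mul (by positivity),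
        inv_mul_cancel₀ hN0.ne', ENNReal.ofReal_one]
    have hloc : LocallyIntegrable (fun x => N⁻¹ * b x) volume := hb.smul N⁻¹
    have h1 : (∫⁻ x in Cube a h, ENNReal.ofReal
        (|N⁻¹ * b x - cubeAvg a h (fun x => N⁻¹ * b x)| * v x)) / Y a h ≤
        ⨆ (b : (Fin n → ℝ) → ℝ) (_ : LocallyIntegrable b volume ∧ bmoNorm b = 1),
          bmoVY v Y b :=
      le_iSup₂_of_le (fun x => N⁻¹ * b x) ⟨hloc, hone⟩
        (le_iSup_of_le a (le_iSup_of_le h (le_iSup_of_le hh le_rfl)))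
    rw [ENNReal.div_le_iff (hY a h hh).1.ne' (hY a h hh).2.ne] at h1
    rw [mul_assoc, hNof]
    refine le_trans (le_of_eq ?_) (mul_le_mul_right h1 _)
    rw [← lintegral_const_mul' _ _ ENNReal.ofReal_ne_top]
    refine lintegral_congr fun x => ?_
    rw [← ENNReal.ofReal_mul hN0.le]
    simp only [cubeAvg_const_mul, ← mul_sub, abs_mul, abs_of_pos (inv_pos.2 hN0)]
    field_simp

lemma ae_le_hlMax_withDensity {n : ℕ} {F : (Fin n → ℝ) → ℝ≥0∞} (hF : AEMeasurable F volume)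
    (hfin : ∫⁻ x, F x ≠ ⊤) : ∀ᵐ x, F x ≤ hlMax (volume.withDensity F) x := by
  filter_upwards [(Besicovitch.vitaliFamily (volume : Measure (Fin n → ℝ))).ae_tendsto_lintegral_div
    hF hfin] with x hx
  refine le_of_tendsto (hx.comp (Besicovitch.tendsto_filterAt volume x)) ?_
  filter_upwards [self_mem_nhdsWithin] with r hr
  refine le_iSup_of_le x (le_iSup_of_le r (le_iSup_of_le (Metric.mem_ball_self hr) ?_))
  rw [withDensity_apply _ Metric.isClosed_closedBall.measurableSet]
  rfl

/-- if `X = sup_{‖b‖_BMO = 1} ‖b‖_{BMO_{v,Y}} < ∞`, then there are dimensional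
constants `α_n, γ_n ≥ 1` such that for every cube `Q` with `v_Q > 0`,
`(1/|Q|) ∫_Q log⁺(v/(α_n² v_Q)) v ≤ γ_n X Y(Q)/|Q|`. -/
theorem stmt16 (n : ℕ) :
    ∃ α γ : ℝ, 1 ≤ α ∧ 1 ≤ γ ∧
      ∀ (v : (Fin n → ℝ) → ℝ) (Y : (Fin n → ℝ) → ℝ → ℝ≥0∞),
        IsWeight v → IsCubeFunctional Y →
        (⨆ (b : (Fin n → ℝ) → ℝ) (_ : LocallyIntegrable b volume ∧ bmoNorm b = 1),
          bmoVY v Y b) < ⊤ →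
        ∀ (a : Fin n → ℝ) (h : ℝ), 0 < h → 0 < cubeAvg a h v →
          (∫⁻ x in Cube a h,
              ENNReal.ofReal (max (Real.log (v x / (α ^ 2 * cubeAvg a h v))) 0 * v x)) /
              volume (Cube a h)
            ≤ ENNReal.ofReal γ *
                (⨆ (b : (Fin n → ℝ) → ℝ) (_ : LocallyIntegrable b volume ∧ bmoNorm b = 1),
                  bmoVY v Y b) * Y a h / volume (Cube a h) := by
  have h5 : (1 : ℝ) ≤ 5 ^ n := one_le_pow₀ (by norm_num)
  have hn3 : 0 ≤ n * Real.log 3 := mul_nonneg n.cast_nonneg (Real.log_nonneg (by norm_num))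
  refine ⟨Real.exp (5 ^ n), 2 * (5 ^ n + n * Real.log 3), Real.one_le_exp (by positivity),
    by linarith, ?_⟩
  intro v Y hv hY _ a h hh hc
  gcongr
  have hh2 : 0 < h / 2 := by positivity
  set c := cubeAvg a h v with hcdef
  have hQ := cube_eq_closedBall a hh
  have hQ0 : volume (Cube a h) ≠ 0 := hQ ▸ volume_closedBall_ne_zero _ hh2
  have hQt : volume (Cube a h) ≠ ⊤ := hQ ▸ volume_closedBall_ne_top _ _
  have hQm : MeasurableSet (Cube a h) := hQ ▸ Metric.isClosed_closedBall.measurableSet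
  have hvint : IntegrableOn v (Cube a h) :=
    hQ ▸ hv.2.integrableOn_isCompact (isCompact_closedBall _ _)
  set F : (Fin n → ℝ) → ℝ≥0∞ := (Cube a h).indicator fun x => ENNReal.ofReal (v x) with hF
  have hFm : AEMeasurable F volume :=
    (hv.2.aestronglyMeasurable.aemeasurable.ennreal_ofReal).indicator hQm
  have hFint : ∫⁻ x, F x = ENNReal.ofReal c * volume (Cube a h) := by
    rw [hF, lintegral_indicator hQm,
      ← ofReal_integral_eq_lintegral_ofReal hvint (ae_of_all _ hv.1)]
    rw [← ENNReal.ofReal_toReal hQt]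
    rw [← ENNReal.ofReal_mul hc.le, hcdef, cubeAvg, setAverage_eq, smul_eq_mul, measureReal_def]
    have := ENNReal.toReal_pos hQ0 hQt
    congr 1
    field_simp
  have hFt : ∫⁻ x, F x ≠ ⊤ := hFint ▸ ENNReal.mul_ne_top ENNReal.ofReal_ne_top hQt
  set μ := volume.withDensity F with hμ
  have hμuniv : μ univ = ENNReal.ofReal c * volume (Cube a h) := by
    rw [hμ, withDensity_apply _ MeasurableSet.univ, setLIntegral_univ, hFint]
  have : IsFiniteMeasure μ := isFiniteMeasure_withDensity hFt
  set b : (Fin n → ℝ) → ℝ := fun x => Real.posLog ((hlMax μ x).toReal / c) with hb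
  have hbloc : LocallyIntegrable b volume := locallyIntegrable_posLog_hlMax μ hc
  have hbmo : bmoNorm b ≤ ENNReal.ofReal (2 * (5 ^ n + n * Real.log 3)) :=
    bmoNorm_posLog_hlMax_le μ hc
  have hbint : ∫⁻ x in Cube a h, ENNReal.ofReal (b x) ≤ 5 ^ n * volume (Cube a h) := by
    rw [hQ] at hμuniv ⊢
    refine lintegral_posLog_hlMax_le μ _ hc (fun z ρ hρ _ => ?_) ?_
    · refine (measure_mono (subset_univ _)).trans (hμuniv.trans_le ?_)
      exact mul_le_mul_right (volume_closedBall_mono _ _ hh2.le hρ.le) _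
    · exact (measure_mono (subset_univ _)).trans hμuniv.le
  have hbavg : cubeAvg a h b ≤ 5 ^ n := by
    have h1 : IntegrableOn b (Cube a h) :=
      hQ ▸ hbloc.integrableOn_isCompact (isCompact_closedBall _ _)
    rw [cubeAvg, setAverage_eq, smul_eq_mul, measureReal_def,
      inv_mul_le_iff₀ (ENNReal.toReal_pos hQ0 hQt)]
    rw [← ofReal_integral_eq_lintegral_ofReal h1 (ae_of_all _ fun x => Real.posLog_nonneg),
      ENNReal.ofReal_le_iff_le_toReal (ENNReal.mul_ne_top (by simp) hQt)] at hbint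
    simpa [mul_comm] using hbint
  calc ∫⁻ x in Cube a h,
        ENNReal.ofReal (max (Real.log (v x / (Real.exp (5 ^ n) ^ 2 * c))) 0 * v x)
      ≤ ∫⁻ x in Cube a h, ENNReal.ofReal (|b x - cubeAvg a h b| * v x) := by
        refine setLIntegral_mono_ae' hQm ?_
        filter_upwards [ae_le_hlMax_withDensity hFm hFt, ae_hlMax_lt_top μ] with x hx hxt hxQ
        rcases (hv.1 x).eq_or_lt with h0 | h0
        · simp [← h0]
        rw [hF, indicator_of_mem hxQ, ← hF, ENNReal.ofReal_le_iff_le_toReal hxt.ne] at hx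
        refine ENNReal.ofReal_le_ofReal (mul_le_mul_of_nonneg_right (max_le ?_ (abs_nonneg _)) h0.le)
        refine le_trans ?_ (le_abs_self _)
        have h1 : Real.log (v x / c) ≤ b x :=
          (le_max_right _ _).trans (Real.posLog_le_posLog (by positivity) (by gcongr))
        have h2 : Real.log (v x / (Real.exp (5 ^ n) ^ 2 * c)) = Real.log (v x / c) - 2 * 5 ^ n := by
          rw [Real.log_div h0.ne' (by positivity), Real.log_mul (by positivity) hc.ne',
            Real.log_pow, Real.log_exp, Real.log_div h0.ne' hc.ne']
          push_cast
          ring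
        linarith
    _ ≤ _ := (lintegral_abs_sub_cubeAvg_mul_le hY hbloc
        (ne_top_of_le_ne_top ENNReal.ofReal_ne_top hbmo) a hh).trans (by gcongr)
end
end

section
/- Let v be a weight on ℝⁿ, Q a cube with v_Q := (1/|Q|)∫_Q v > 0, and set c_n = 2‖M‖_{L¹(ℝⁿ)→L^{1,∞}(ℝⁿ)}^{1/2}, w = M(v χ_Q / v_Q)^{1/2}, and b = log w. Then b_Q ≤ log c_n, and for a.e. x ∈ Q with v(x) ≥ c_n² v_Q one has |b(x) − b_Q| ≥ (1/2) log( v(x) / (c_n² v_Q) ). -/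
open MeasureTheory ENNReal Set

noncomputable section

theorem cube_sub_eq_closedBall {n : ℕ} (x : Fin n → ℝ) {r : ℝ} (hr : 0 ≤ r) :
    Cube (fun i => x i - r) (2 * r) = Metric.closedBall x r := by
  ext y
  simp only [Cube, Set.mem_univ_pi, Set.mem_Icc, Metric.mem_closedBall, dist_pi_le_iff hr,
    Real.dist_eq, abs_le]
  refine forall_congr' fun i => ⟨fun ⟨_, _⟩ => ⟨?_, ?_⟩, fun ⟨_, _⟩ => ⟨?_, ?_⟩⟩ <;> linarith

theorem isCompact_cube {n : ℕ} (a : Fin n → ℝ) (h : ℝ) : IsCompact (Cube a h) :=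
  isCompact_univ_pi fun _ => isCompact_Icc

theorem measurableSet_cube {n : ℕ} (a : Fin n → ℝ) (h : ℝ) : MeasurableSet (Cube a h) :=
  (isCompact_cube a h).measurableSet

theorem volume_cube_ne_top {n : ℕ} (a : Fin n → ℝ) (h : ℝ) : volume (Cube a h) ≠ ⊤ :=
  (isCompact_cube a h).measure_lt_top.ne

theorem volume_cube_ne_zero {n : ℕ} (a : Fin n → ℝ) {h : ℝ} (hh : 0 < h) :
    volume (Cube a h) ≠ 0 := by
  rw [Cube, volume_pi_pi]
  simp [hh]

theorem le_maxFn {n : ℕ} (f : (Fin n → ℝ) → ℝ) {x a : Fin n → ℝ} {h : ℝ} (hh : 0 < h)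
    (hx : x ∈ Cube a h) :
    (∫⁻ y in Cube a h, ENNReal.ofReal |f y|) / volume (Cube a h) ≤ maxFn f x :=
  le_iSup₂_of_le a h (le_iSup₂_of_le hh hx le_rfl)

theorem ofReal_cubeAvg {n : ℕ} {f : (Fin n → ℝ) → ℝ} (hf0 : ∀ x, 0 ≤ f x) (a : Fin n → ℝ)
    (h : ℝ) (hf : IntegrableOn f (Cube a h)) :
    ENNReal.ofReal (cubeAvg a h f) =
      (∫⁻ y in Cube a h, ENNReal.ofReal |f y|) / volume (Cube a h) := by
  simp_rw [abs_of_nonneg (hf0 _)]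
  exact ofReal_setAverage hf (ae_of_all _ hf0)

theorem ae_ofReal_le_maxFn {n : ℕ} {f : (Fin n → ℝ) → ℝ} (hf0 : ∀ x, 0 ≤ f x)
    (hf : Integrable f) : ∀ᵐ x, ENNReal.ofReal (f x) ≤ maxFn f x := by
  filter_upwards [IsUnifLocDoublingMeasure.ae_tendsto_average
    (volume : Measure (Fin n → ℝ)) hf.locallyIntegrable 1] with x hx
  have hlim := hx (l := nhdsWithin 0 (Ioi (0 : ℝ))) (fun _ => x) id Filter.tendsto_id
    (by filter_upwards [self_mem_nhdsWithin] with r hr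
        exact Metric.mem_closedBall_self (by simpa using (mem_Ioi.1 hr).le))
  refine le_of_tendsto (ENNReal.tendsto_ofReal hlim) ?_
  filter_upwards [self_mem_nhdsWithin] with r hr
  have hr' : 0 < r := hr
  have hx' : x ∈ Cube (fun i => x i - r) (2 * r) := by
    rw [cube_sub_eq_closedBall x hr'.le]
    exact Metric.mem_closedBall_self hr'.le
  have key := le_maxFn f (by positivity) hx'
  rw [← ofReal_cubeAvg hf0 _ _ hf.integrableOn] at key
  simpa [cubeAvg, cube_sub_eq_closedBall x hr'.le] using key

theorem ae_maxFn_ne_top {n : ℕ} {f : (Fin n → ℝ) → ℝ} {C : ℝ}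
    (hC : ∀ t : ℝ, 0 < t → ENNReal.ofReal t * volume {x | ENNReal.ofReal t < maxFn f x} ≤
        ENNReal.ofReal C * ∫⁻ x, ENNReal.ofReal |f x|)
    (hf : Integrable f) : ∀ᵐ x, maxFn f x ≠ ⊤ := by
  have hfin : ENNReal.ofReal C * ∫⁻ x, ENNReal.ofReal |f x| ≠ ⊤ :=
    ENNReal.mul_ne_top ENNReal.ofReal_ne_top hf.abs.lintegral_lt_top.ne
  rw [ae_iff]
  by_contra h0
  obtain ⟨k, hk⟩ := ENNReal.exists_nat_mul_gt h0 hfin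
  have hk0 : 0 < k := Nat.pos_of_ne_zero (by rintro rfl; simp at hk)
  refine hk.not_ge (le_trans ?_ (hC k (by exact_mod_cast hk0)))
  rw [ENNReal.ofReal_natCast]
  gcongr
  intro htop
  simp [not_not.1 htop]

/-- If `|{g > s}| ≤ C e^{-2s} |X|` for all `s ≥ (log C) / 2`, then the average of `g ≥ 0` is at
most `(log C + 1) / 2`. -/
theorem average_le_of_measure_lt_le_exp {X : Type*} [MeasurableSpace X] {μ : Measure X}
    [IsFiniteMeasure μ] {g : X → ℝ} (hg : 0 ≤ᵐ[μ] g) {C : ℝ} (hC : 1 ≤ C)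
    (htail : ∀ s, 0 < s → μ {x | s < g x} ≤ ENNReal.ofReal (C * Real.exp (-2 * s)) * μ univ) :
    ⨍ x, g x ∂μ ≤ (Real.log C + 1) / 2 := by
  have hL : 0 ≤ Real.log C / 2 := by have := Real.log_nonneg hC; positivity
  by_cases hm : AEStronglyMeasurable g μ
  swap
  · rw [average_eq, integral_non_aestronglyMeasurable hm]
    simp only [smul_zero]; linarith
  have hexp : ∫⁻ s in Ioi (Real.log C / 2), ENNReal.ofReal (C * Real.exp (-2 * s)) =
      ENNReal.ofReal (1 / 2) := by
    rw [← ofReal_integral_eq_lintegral_ofReal]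
    · rw [integral_const_mul, integral_exp_mul_Ioi (by norm_num)]
      congr 1
      rw [show -2 * (Real.log C / 2) = -Real.log C by ring, Real.exp_neg,
        Real.exp_log (by linarith)]
      field_simp
    · exact (integrableOn_exp_mul_Ioi (by norm_num) _).const_mul C
    · exact ae_of_all _ fun s => by positivity
  have hbound : ∫⁻ x, ENNReal.ofReal (g x) ∂μ ≤
      ENNReal.ofReal ((Real.log C + 1) / 2) * μ univ := by
    rw [lintegral_eq_lintegral_meas_lt μ hg hm.aemeasurable, ← Ioc_union_Ioi_eq_Ioi hL,
      lintegral_union measurableSet_Ioi (Ioc_disjoint_Ioi le_rfl)]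
    calc _ ≤ (∫⁻ _ in Ioc 0 (Real.log C / 2), μ univ) +
          ∫⁻ s in Ioi (Real.log C / 2), ENNReal.ofReal (C * Real.exp (-2 * s)) * μ univ := by
            refine add_le_add (lintegral_mono fun s => measure_mono (subset_univ _)) ?_
            exact setLIntegral_mono' measurableSet_Ioi fun s hs => htail s (hL.trans_lt hs)
      _ = _ := by
        rw [lintegral_mul_const' _ _ (measure_ne_top _ _), hexp, setLIntegral_const,
          Real.volume_Ioc, mul_comm, ← add_mul, ← ENNReal.ofReal_add (by linarith) (by norm_num)]
        congr 2; ring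
  rw [average_eq, integral_eq_lintegral_of_nonneg_ae hg hm, smul_eq_mul]
  have hreal := ENNReal.toReal_mono
    (ENNReal.mul_ne_top ENNReal.ofReal_ne_top (measure_ne_top μ univ)) hbound
  rw [ENNReal.toReal_mul, ENNReal.toReal_ofReal (by linarith)] at hreal
  rcases eq_or_lt_of_le (measureReal_nonneg (μ := μ) (s := univ)) with h0 | h0
  · rw [← h0]; simp only [_root_.inv_zero, zero_mul]; linarith
  · rw [inv_mul_le_iff₀ h0, mul_comm]
    exact hreal

/-- with `c_n = 2‖M‖_{L¹→L^{1,∞}}^{1/2}`, `w = M(v χ_Q / v_Q)^{1/2}` and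
`b = log w`, one has `b_Q ≤ log c_n`, and for a.e. `x ∈ Q` with `v(x) ≥ c_n² v_Q`,
`|b(x) - b_Q| ≥ (1/2) log(v(x)/(c_n² v_Q))`. Here `CM` is any weak-`(1,1)` bound for `M`. -/
theorem stmt17 (n : ℕ) (CM : ℝ) (hCM1 : 1 ≤ CM)
    (hCM : ∀ (f : (Fin n → ℝ) → ℝ) (t : ℝ), 0 < t →
      ENNReal.ofReal t * volume {x | ENNReal.ofReal t < maxFn f x} ≤
        ENNReal.ofReal CM * ∫⁻ x, ENNReal.ofReal |f x|)
    (v : (Fin n → ℝ) → ℝ) (hv : IsWeight v)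
    (a : Fin n → ℝ) (h : ℝ) (hh : 0 < h) (hvQ : 0 < cubeAvg a h v) :
    (⨍ x in Cube a h,
        Real.log (Real.sqrt ((maxFn ((Cube a h).indicator v) x).toReal / cubeAvg a h v)))
      ≤ Real.log (2 * Real.sqrt CM) ∧
    ∀ᵐ x ∂volume.restrict (Cube a h),
      (2 * Real.sqrt CM) ^ 2 * cubeAvg a h v ≤ v x →
        (1 / 2) * Real.log (v x / ((2 * Real.sqrt CM) ^ 2 * cubeAvg a h v)) ≤
          |Real.log (Real.sqrt ((maxFn ((Cube a h).indicator v) x).toReal / cubeAvg a h v)) -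
            ⨍ y in Cube a h,
              Real.log (Real.sqrt
                ((maxFn ((Cube a h).indicator v) y).toReal / cubeAvg a h v))| := by
  set A := cubeAvg a h v
  set f := (Cube a h).indicator v
  have hf0 : ∀ x, 0 ≤ f x := fun x => indicator_nonneg (fun y _ => hv.1 y) x
  have hvint : IntegrableOn v (Cube a h) := hv.2.integrableOn_isCompact (isCompact_cube a h)
  have hf : Integrable f := hvint.integrable_indicator (measurableSet_cube a h)
  have hAvg : ENNReal.ofReal A =
      (∫⁻ y in Cube a h, ENNReal.ofReal |v y|) / volume (Cube a h) :=
    ofReal_cubeAvg hv.1 a h hvint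
  have hfv : ∫⁻ y, ENNReal.ofReal |f y| = ∫⁻ y in Cube a h, ENNReal.ofReal |v y| := by
    rw [← lintegral_indicator (measurableSet_cube a h)]
    congr 1 with y
    by_cases hy : y ∈ Cube a h <;> simp [f, hy]
  have hfv' : ∫⁻ y in Cube a h, ENNReal.ofReal |f y| =
      ∫⁻ y in Cube a h, ENNReal.ofReal |v y| :=
    setLIntegral_congr_fun (measurableSet_cube a h) fun y hy => by simp [f, hy]
  have hfA : ∫⁻ y, ENNReal.ofReal |f y| = ENNReal.ofReal A * volume (Cube a h) := by
    rw [hfv, hAvg, ENNReal.div_mul_cancel (volume_cube_ne_zero a hh) (volume_cube_ne_top a h)]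
  have hlower : ∀ x ∈ Cube a h, ENNReal.ofReal A ≤ maxFn f x := fun x hx => by
    rw [hAvg, ← hfv']
    exact le_maxFn f hh hx
  have hfin := ae_maxFn_ne_top (hCM f) hf
  have hCM0 : 0 < CM := by linarith
  have : IsFiniteMeasure (volume.restrict (Cube a h)) :=
    isFiniteMeasure_restrict.2 (volume_cube_ne_top a h)
  have hb : (⨍ x in Cube a h, Real.log (Real.sqrt ((maxFn f x).toReal / A))) ≤
      Real.log (2 * Real.sqrt CM) := by
    refine (average_le_of_measure_lt_le_exp (C := CM) ?_ hCM1 fun s hs => ?_).trans ?_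
    · filter_upwards [ae_restrict_mem (measurableSet_cube a h), ae_restrict_of_ae hfin]
        with x hx hx'
      refine Real.log_nonneg (Real.one_le_sqrt.2 ((one_le_div hvQ).2 ?_))
      exact (ENNReal.ofReal_le_iff_le_toReal hx').1 (hlower x hx)
    · have hpos : 0 < A * Real.exp (2 * s) := by positivity
      have hsub : {x | s < Real.log (Real.sqrt ((maxFn f x).toReal / A))} ⊆
          {x | ENNReal.ofReal (A * Real.exp (2 * s)) < maxFn f x} := by
        intro x hx
        have hx' : s < Real.log (Real.sqrt ((maxFn f x).toReal / A)) := hx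
        have hFnonneg : 0 ≤ (maxFn f x).toReal / A := by positivity
        rw [Real.log_sqrt hFnonneg] at hx'
        have hF : 0 < (maxFn f x).toReal / A := by
          refine hFnonneg.lt_of_ne fun h0 => ?_
          rw [← h0, Real.log_zero] at hx'
          linarith
        have hlt : Real.exp (2 * s) < (maxFn f x).toReal / A :=
          (Real.lt_log_iff_exp_lt hF).1 (by linarith)
        rw [lt_div_iff₀ hvQ, mul_comm] at hlt
        exact (ENNReal.ofReal_lt_iff_lt_toReal hpos.le
          fun htop => by simp [htop] at hF).2 hlt
      have hweak := hCM f _ hpos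
      rw [hfA] at hweak
      rw [Measure.restrict_apply_univ]
      refine (Measure.restrict_apply_le _ _).trans ((measure_mono hsub).trans ?_)
      have hne : ENNReal.ofReal (A * Real.exp (2 * s)) ≠ 0 := by simpa using hpos
      rw [← ENNReal.mul_le_mul_iff_right hne ENNReal.ofReal_ne_top]
      refine hweak.trans_eq ?_
      rw [← mul_assoc, ← mul_assoc, ← ENNReal.ofReal_mul hCM0.le, ← ENNReal.ofReal_mul hpos.le]
      congr 2
      rw [show -2 * s = -(2 * s) by ring, Real.exp_neg]
      field_simp
    · rw [Real.log_mul (by norm_num) (Real.sqrt_pos.2 hCM0).ne', Real.log_sqrt hCM0.le]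
      linarith [Real.log_two_gt_d9]
  refine ⟨hb, ?_⟩
  filter_upwards [ae_restrict_mem (measurableSet_cube a h), ae_restrict_of_ae hfin,
    ae_restrict_of_ae (ae_ofReal_le_maxFn hf0 hf)] with x hx hx' hle hvx
  have hc : 0 < (2 * Real.sqrt CM) ^ 2 * A := by positivity
  have hvpos : 0 < v x := hc.trans_le hvx
  have hvM : v x ≤ (maxFn f x).toReal := by
    have := (ENNReal.ofReal_le_iff_le_toReal hx').1 hle
    simpa [f, hx] using this
  have hlog : Real.log (v x) ≤ Real.log (maxFn f x).toReal := Real.log_le_log hvpos hvM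
  refine le_trans ?_ (le_abs_self _)
  rw [Real.log_sqrt (by positivity), Real.log_div (hvpos.trans_le hvM).ne' hvQ.ne',
    Real.log_div hvpos.ne' hc.ne', Real.log_mul (by positivity) hvQ.ne', Real.log_pow]
  push_cast
  linarith
end
end
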